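/- arXiv:2205.06338 — 2 statements merged into one kernel-verified Lean document; each statement's English description precedes it below -/
import Mathlib

section
/- Let β > 0, let u_1 < u_2 < … < u_N be a finite strictly increasing sequence of real numbers with u_0 := 0 ≤ u_1, and let s_1 < s_2 < … < s_M be another finite strictly increasing sequence of real numbers in [0, ∞). Define R(0) = 0 and, for 1 ≤ i ≤ N, R(i) = e^{−β(u_i − u_{i−1})} R(i−1) + Σ_{n : u_{i−1} ≤ s_n < u_i} e^{−β(u_i − s_n)}. Then for every i ∈ {1,…,N}, R(i) = Σ_{n : s_n < u_i} e^{−β(u_i − s_n)}. -/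
open Finset

/-- One step of the recursion: discounting the exponential sum over the points before `a` and
adding the points in `[a, b)` gives the exponential sum over the points before `b`. -/
theorem exp_decay_sum_step {ι : Type*} [Fintype ι] (β : ℝ) (s : ι → ℝ) {a b : ℝ} (hab : a ≤ b) :
    Real.exp (-β * (b - a)) *
          ∑ n ∈ Finset.univ.filter (fun n => s n < a), Real.exp (-β * (a - s n)) +
        ∑ n ∈ Finset.univ.filter (fun n => a ≤ s n ∧ s n < b), Real.exp (-β * (b - s n)) =
      ∑ n ∈ Finset.univ.filter (fun n => s n < b), Real.exp (-β * (b - s n)) := by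
  simp only [Finset.sum_filter, Finset.mul_sum, ← Finset.sum_add_distrib]
  refine Finset.sum_congr rfl fun n _ => ?_
  rcases lt_or_ge (s n) a with h | h
  · rw [if_pos h, if_neg fun h' => absurd h'.1 h.not_ge, if_pos (h.trans_le hab), add_zero,
      ← Real.exp_add]
    ring_nf
  · simp [h, h.not_gt]

/-- **Closed form of the recursive quantity `R_{jl}(i)` in the Hawkes
log-likelihood.**  Let `β > 0`, let `u 1 < u 2 < ⋯ < u N` be a strictly
increasing sequence with `u 0 = 0 ≤ u 1`, and let `s 0 < ⋯ < s (M-1)` be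
another strictly increasing sequence of nonnegative reals.  If `R 0 = 0` and
`R i = e^{-β(u i - u (i-1))} R (i-1) + ∑_{n : u (i-1) ≤ s n < u i} e^{-β(u i - s n)}`
for `1 ≤ i ≤ N`, then `R i = ∑_{n : s n < u i} e^{-β(u i - s n)}`. -/
theorem hawkes_R_closed_form
    (β : ℝ) (hβ : 0 < β)
    (N : ℕ) (u : ℕ → ℝ) (hu0 : u 0 = 0) (hu01 : 1 ≤ N → u 0 ≤ u 1)
    (hu_mono : ∀ i, 1 ≤ i → i < N → u i < u (i + 1))
    (M : ℕ) (s : Fin M → ℝ) (hs_mono : StrictMono s) (hs_nonneg : ∀ n, 0 ≤ s n)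
    (R : ℕ → ℝ) (hR0 : R 0 = 0)
    (hRrec : ∀ i, 1 ≤ i → i ≤ N →
      R i = Real.exp (-β * (u i - u (i - 1))) * R (i - 1) +
        ∑ n ∈ Finset.univ.filter (fun n : Fin M => u (i - 1) ≤ s n ∧ s n < u i),
          Real.exp (-β * (u i - s n))) :
    ∀ i, 1 ≤ i → i ≤ N →
      R i = ∑ n ∈ Finset.univ.filter (fun n : Fin M => s n < u i),
        Real.exp (-β * (u i - s n)) := by
  have key : ∀ i, i ≤ N →
      R i = ∑ n ∈ Finset.univ.filter (fun n : Fin M => s n < u i),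
        Real.exp (-β * (u i - s n)) := by
    intro i
    induction i with
    | zero =>
      intro _
      rw [hR0, hu0, Finset.filter_false_of_mem fun n _ => (hs_nonneg n).not_gt,
        Finset.sum_empty]
    | succ k ih =>
      intro hk
      have hle : u k ≤ u (k + 1) := by
        rcases Nat.eq_zero_or_pos k with rfl | hpos
        · exact hu01 hk
        · exact (hu_mono k hpos hk).le
      rw [hRrec (k + 1) (Nat.le_add_left 1 k) hk, Nat.add_sub_cancel, ih (Nat.le_of_succ_le hk)]
      exact exp_decay_sum_step β s hle
  exact fun i _ hi => key i hi
end

section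
/- Let m be a positive integer, let T > 0, and for each k ∈ {1,…,m} let t^{(k)}_1 < t^{(k)}_2 < … < t^{(k)}_{N_k} be a finite strictly increasing sequence of arrival times in (0, T). Let μ_j > 0, α_{jk} > 0, β_{jk} > 0 for all j, k ∈ {1,…,m}. For each pair (j, l), define R_{jl}(0) = 0 and R_{jl}(i) = e^{−β_{jl}(t^{(j)}_i − t^{(j)}_{i−1})} R_{jl}(i−1) + Σ_{n : t^{(j)}_{i−1} ≤ t^{(l)}_n < t^{(j)}_i} e^{−β_{jl}(t^{(j)}_i − t^{(l)}_n)} for 1 ≤ i ≤ N_j, where t^{(j)}_0 := 0. Define the conditional intensity λ_j(t) = μ_j + Σ_{k=1}^m Σ_{i : t^{(k)}_i < t} α_{jk} e^{−β_{jk}(t − t^{(k)}_i)}. Then Σ_{j=1}^m ( −∫_0^T λ_j(t) dt + Σ_{i=1}^{N_j} log λ_j(t^{(j)}_i) ) = Σ_{j=1}^m ( −μ_j T − Σ_{k=1}^m (α_{jk}/β_{jk}) Σ_{i=1}^{N_k} (1 − e^{−β_{jk}(T − t^{(k)}_i)}) + Σ_{i=1}^{N_j} log( μ_j + Σ_{l=1}^m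 α_{jl} R_{jl}(i) ) ). -/
open MeasureTheory Finset

/-- An exponential kernel started at `τ` is interval integrable on `[0, T]`. -/
lemma intervalIntegrable_truncated_exp {T : ℝ} (hT : 0 ≤ T) (a b τ : ℝ) :
    IntervalIntegrable (fun s => if τ < s then a * Real.exp (-b * (s - τ)) else 0)
      volume 0 T := by
  have hc : Continuous fun s : ℝ => a * Real.exp (-b * (s - τ)) := by fun_prop
  have h := ((intervalIntegrable_iff_integrableOn_Ioc_of_le hT).1
    (hc.intervalIntegrable (μ := volume) 0 T)).indicator (measurableSet_Ioi (a := τ))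
  refine (intervalIntegrable_iff_integrableOn_Ioc_of_le hT).2 (h.congr ?_)
  exact Filter.Eventually.of_forall fun s => by simp [Set.indicator_apply]

/-- The integral over `[0, T]` of an exponential kernel started at `τ ∈ [0, T]`. -/
lemma integral_truncated_exp {T τ b : ℝ} (h0 : 0 ≤ τ) (hτ : τ ≤ T) (hb : b ≠ 0) (a : ℝ) :
    ∫ s in (0 : ℝ)..T, (if τ < s then a * Real.exp (-b * (s - τ)) else 0) =
      a / b * (1 - Real.exp (-b * (T - τ))) := by
  have hind : (fun s : ℝ => if τ < s then a * Real.exp (-b * (s - τ)) else 0) =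
      (Set.Ioi τ).indicator fun s => a * Real.exp (-b * (s - τ)) := by
    ext s
    simp [Set.indicator_apply]
  have hset : Set.Ioc 0 T ∩ Set.Ioi τ = Set.Ioc τ T := by
    rw [Set.Ioc_inter_Ioi, max_eq_right h0]
  have hc : Continuous fun s : ℝ => a * Real.exp (-b * (s - τ)) := by fun_prop
  rw [intervalIntegral.integral_of_le (h0.trans hτ), hind,
    setIntegral_indicator measurableSet_Ioi, hset, ← intervalIntegral.integral_of_le hτ,
    intervalIntegral.integral_eq_sub_of_hasDerivAt
      (f := fun s => -(a / b) * Real.exp (-b * (s - τ))) (fun s _ => ?_)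
      (hc.intervalIntegrable τ T)]
  · simp only [sub_self, mul_zero, Real.exp_zero]
    ring
  · have h := ((((hasDerivAt_id s).sub_const τ).const_mul (-b)).exp).const_mul (-(a / b))
    refine h.congr_deriv ?_
    simp only [id]
    field_simp

/-- A quantity satisfying the exponential-decay recursion along the grid `u` is the sum of all
decayed contributions of the points `v n` lying strictly before the current grid point. -/
lemma exp_recursion_eq_sum {M K : ℕ} {u v r : ℕ → ℝ} {b : ℝ}
    (hu0 : u 0 = 0) (hu : ∀ i, i < M → u i < u (i + 1))
    (hv : ∀ n, 1 ≤ n → n ≤ K → 0 < v n) (hr0 : r 0 = 0)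
    (hr : ∀ i, 1 ≤ i → i ≤ M → r i = Real.exp (-b * (u i - u (i - 1))) * r (i - 1) +
      ∑ n ∈ (Finset.Icc 1 K).filter (fun n => u (i - 1) ≤ v n ∧ v n < u i),
        Real.exp (-b * (u i - v n))) :
    ∀ i, i ≤ M → r i = ∑ n ∈ (Finset.Icc 1 K).filter (fun n => v n < u i),
      Real.exp (-b * (u i - v n)) := by
  intro i
  induction i with
  | zero =>
    intro _
    rw [hr0, eq_comm]
    refine Finset.sum_eq_zero fun n hn => ?_
    simp only [Finset.mem_filter, Finset.mem_Icc, hu0] at hn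
    exact absurd hn.2 (hv n hn.1.1 hn.1.2).le.not_gt
  | succ i ih =>
    intro hi
    have hlt := hu i hi
    rw [hr (i + 1) (by omega) hi, Nat.add_sub_cancel, ih (by omega), Finset.mul_sum]
    simp only [Finset.sum_filter]
    rw [← Finset.sum_add_distrib]
    refine Finset.sum_congr rfl fun n _ => ?_
    by_cases h : v n < u i
    · rw [if_pos h, if_neg (fun h' => h'.1.not_gt h), if_pos (h.trans hlt), ← Real.exp_add,
        add_zero]
      congr 1
      ring
    · simp [h, not_lt.1 h]

/-- **Closed-form log-likelihood of the multivariate Hawkes process with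
exponential kernels.**  For an `m`-variate Hawkes process with background
intensities `μ j > 0`, kernels `f_{jk}(s) = α_{jk} e^{-β_{jk} s}`, and strictly
increasing arrival times `0 = t k 0 < t k 1 < ⋯ < t k (N k) < T` (indices
`1, …, N k` being the actual arrivals, all in `(0, T)`), with the recursively
defined quantities `R j l i`, the point-process log-likelihood
`∑_j (-∫_0^T λ_j + ∑_i log λ_j(t^{(j)}_i))` equals
`∑_j (-μ_j T - ∑_k (α_{jk}/β_{jk}) ∑_i (1 - e^{-β_{jk}(T - t^{(k)}_i)})
  + ∑_i log(μ_j + ∑_l α_{jl} R j l i))`. -/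
theorem hawkes_loglikelihood_closed_form
    (m : ℕ) (hm : 0 < m) (T : ℝ) (hT : 0 < T)
    (N : Fin m → ℕ) (t : Fin m → ℕ → ℝ)
    (ht0 : ∀ k, t k 0 = 0)
    (ht_mono : ∀ k, ∀ i, i < N k → t k i < t k (i + 1))
    (ht_mem : ∀ k, ∀ i, 1 ≤ i → i ≤ N k → t k i ∈ Set.Ioo (0 : ℝ) T)
    (μ : Fin m → ℝ) (α β : Fin m → Fin m → ℝ)
    (hμ : ∀ j, 0 < μ j) (hα : ∀ j k, 0 < α j k) (hβ : ∀ j k, 0 < β j k)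
    (R : Fin m → Fin m → ℕ → ℝ)
    (hR0 : ∀ j l, R j l 0 = 0)
    (hRrec : ∀ j l, ∀ i, 1 ≤ i → i ≤ N j →
      R j l i = Real.exp (-(β j l) * (t j i - t j (i - 1))) * R j l (i - 1) +
        ∑ n ∈ (Finset.Icc 1 (N l)).filter
            (fun n => t j (i - 1) ≤ t l n ∧ t l n < t j i),
          Real.exp (-(β j l) * (t j i - t l n)))
    (lam : Fin m → ℝ → ℝ)
    (hlam : ∀ j s, lam j s =
      μ j + ∑ k : Fin m, ∑ i ∈ (Finset.Icc 1 (N k)).filter (fun i => t k i < s),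
        α j k * Real.exp (-(β j k) * (s - t k i))) :
    ∑ j : Fin m,
        (-(∫ s in (0 : ℝ)..T, lam j s) +
          ∑ i ∈ Finset.Icc 1 (N j), Real.log (lam j (t j i))) =
      ∑ j : Fin m,
        (-(μ j * T) -
          ∑ k : Fin m, (α j k / β j k) *
            ∑ i ∈ Finset.Icc 1 (N k), (1 - Real.exp (-(β j k) * (T - t k i))) +
          ∑ i ∈ Finset.Icc 1 (N j),
            Real.log (μ j + ∑ l : Fin m, α j l * R j l i)) := by
  have hint : ∀ j, ∫ s in (0 : ℝ)..T, lam j s = μ j * T + ∑ k : Fin m, (α j k / β j k) *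
      ∑ i ∈ Finset.Icc 1 (N k), (1 - Real.exp (-(β j k) * (T - t k i))) := by
    intro j
    simp only [hlam, Finset.sum_filter]
    have hi : ∀ k i, IntervalIntegrable
        (fun s => if t k i < s then α j k * Real.exp (-(β j k) * (s - t k i)) else 0)
        volume 0 T :=
      fun k i => intervalIntegrable_truncated_exp hT.le _ _ _
    have hk : ∀ k, IntervalIntegrable (fun s => ∑ i ∈ Finset.Icc 1 (N k),
        if t k i < s then α j k * Real.exp (-(β j k) * (s - t k i)) else 0) volume 0 T := by
      intro k
      simpa only [Finset.sum_fn] using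
        IntervalIntegrable.sum (Finset.Icc 1 (N k)) fun i _ => hi k i
    have hs : IntervalIntegrable (fun s => ∑ k : Fin m, ∑ i ∈ Finset.Icc 1 (N k),
        if t k i < s then α j k * Real.exp (-(β j k) * (s - t k i)) else 0) volume 0 T := by
      simpa only [Finset.sum_fn] using IntervalIntegrable.sum Finset.univ fun k _ => hk k
    rw [intervalIntegral.integral_add intervalIntegrable_const hs,
      intervalIntegral.integral_finsetSum fun k _ => hk k]
    congr 1
    · simp [mul_comm]
    · refine Finset.sum_congr rfl fun k _ => ?_
      rw [intervalIntegral.integral_finsetSum fun i _ => hi k i, Finset.mul_sum]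
      refine Finset.sum_congr rfl fun i hik => ?_
      rw [Finset.mem_Icc] at hik
      have hmem := ht_mem k i hik.1 hik.2
      exact integral_truncated_exp hmem.1.le hmem.2.le (hβ j k).ne' _
  refine Finset.sum_congr rfl fun j _ => ?_
  rw [hint j, neg_add']
  congr 1
  refine Finset.sum_congr rfl fun i hij => ?_
  rw [hlam]
  congr 2
  refine Finset.sum_congr rfl fun l _ => ?_
  rw [exp_recursion_eq_sum (ht0 j) (ht_mono j) (fun n h1 h2 => (ht_mem l n h1 h2).1) (hR0 j l)
    (hRrec j l) i (Finset.mem_Icc.1 hij).2, Finset.mul_sum]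
end
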